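/- arXiv:1801.09667 — 4 statements merged into one kernel-verified Lean document; each statement's English description precedes it below -/
import Mathlib

section
/- There exists a Borel probability measure μ* on 𝒳 whose support consists of at most two points, such that Ψ(μ*) ≤ Ψ(μ) for every Borel probability measure μ on 𝒳; i.e., the minimum of the ratio Ψ over all Borel probability measures is attained by a measure supported on at most two actions. -/
open MeasureTheory
open scoped ENNReal

/-- The ratio `Ψ(μ) = (∫ Δ dμ)² / (∫ g dμ)`, valued in `[0,∞]` with the convention
`0/0 = 0` (in `ℝ≥0∞`, `a/0 = ∞` for `a ≠ 0` and `0/0 = 0`). -/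
noncomputable def ratioPsi {X : Type*} [MeasurableSpace X] (Δ g : X → ℝ)
    (μ : Measure X) : ℝ≥0∞ :=
  ENNReal.ofReal ((∫ x, Δ x ∂μ)^2) / ENNReal.ofReal (∫ x, g x ∂μ)

open Filter Topology

section Mixture

variable {X : Type*} [MeasurableSpace X]

/-- The mixture of `μ` with a point mass at `x` of weight `t`. -/
noncomputable def diracMixture (μ : Measure X) (x : X) (t : ℝ) : Measure X :=
  ENNReal.ofReal (1 - t) • μ + ENNReal.ofReal t • Measure.dirac x

theorem isProbabilityMeasure_diracMixture (μ : Measure X) [IsProbabilityMeasure μ] (x : X)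
    {t : ℝ} (h0 : 0 ≤ t) (h1 : t ≤ 1) : IsProbabilityMeasure (diracMixture μ x t) := by
  constructor
  simp [diracMixture, ← ENNReal.ofReal_add (sub_nonneg.2 h1) h0]

theorem integral_diracMixture [MeasurableSingletonClass X] {μ : Measure X} (x : X)
    {t : ℝ} (h0 : 0 ≤ t) (h1 : t ≤ 1) {f : X → ℝ} (hf : Integrable f μ) :
    ∫ z, f z ∂(diracMixture μ x t) = (1 - t) * ∫ z, f z ∂μ + t * f x := by
  rw [diracMixture, integral_add_measure (hf.smul_measure ENNReal.ofReal_ne_top)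
    ((integrable_dirac (by simp)).smul_measure ENNReal.ofReal_ne_top)]
  simp [integral_smul_measure, ENNReal.toReal_ofReal, h0, sub_nonneg.2 h1]

end Mixture

theorem ENNReal.ofReal_div_ofReal_le_of_mul_le {a b c d : ℝ} (hb : 0 < b) (hc : 0 < c)
    (h : d * a ≤ b * c) :
    ENNReal.ofReal a / ENNReal.ofReal b ≤ ENNReal.ofReal c / ENNReal.ofReal d := by
  rcases le_or_gt d 0 with hd | hd
  · rw [ENNReal.ofReal_of_nonpos hd, ENNReal.div_zero (by simpa using hc)]
    exact le_top
  · rw [← ENNReal.ofReal_div_of_pos hb, ← ENNReal.ofReal_div_of_pos hd]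
    refine ENNReal.ofReal_le_ofReal ?_
    rw [div_le_div_iff₀ hb hd]
    linarith

/-- If `b / a ^ 2` is maximal along the segment from `(a, b)` to `(d, c)`, then `(d, c)` lies
below the tangent to the parabola through `(a, b)`. -/
theorem tangent_bound_of_segment {a b c d : ℝ} (ha : 0 < a)
    (h : ∀ t : ℝ, 0 < t → t ≤ 1 →
      ((1 - t) * b + t * c) * a ^ 2 ≤ b * ((1 - t) * a + t * d) ^ 2) :
    a * c ≤ 2 * b * d - a * b := by
  have key : ∀ t : ℝ, 0 < t → t ≤ 1 →
      a ^ 2 * (c - b) ≤ 2 * a * b * (d - a) + t * (b * (d - a) ^ 2) := by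
    intro t ht ht1
    refine le_of_mul_le_mul_left ?_ ht
    linarith [h t ht ht1]
  have hlim : Tendsto (fun t : ℝ => 2 * a * b * (d - a) + t * (b * (d - a) ^ 2)) (𝓝[>] 0)
      (𝓝 (2 * a * b * (d - a) + 0 * (b * (d - a) ^ 2))) :=
    Continuous.tendsto (by fun_prop) 0 |>.mono_left nhdsWithin_le_nhds
  have hle := ge_of_tendsto hlim (by
    filter_upwards [Ioc_mem_nhdsGT (zero_lt_one (α := ℝ))] with t ht using key t ht.1 ht.2)
  refine le_of_mul_le_mul_left ?_ ha
  linarith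

/-- Some probability measure maximizes `∫ g / (∫ Δ) ^ 2` when `Δ` is positive. -/
theorem exists_probabilityMeasure_mul_sq_integral_le
    {X : Type*} [MetricSpace X] [CompactSpace X] [Nonempty X] [MeasurableSpace X] [BorelSpace X]
    {Δ g : X → ℝ} (hΔc : Continuous Δ) (hgc : Continuous g)
    (hΔ : ∀ μ : Measure X, IsProbabilityMeasure μ → 0 < ∫ x, Δ x ∂μ) :
    ∃ μ : Measure X, IsProbabilityMeasure μ ∧ ∀ ν : Measure X, IsProbabilityMeasure ν →
      (∫ x, g x ∂ν) * (∫ x, Δ x ∂μ) ^ 2 ≤ (∫ x, g x ∂μ) * (∫ x, Δ x ∂ν) ^ 2 := by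
  have cont : ∀ f : X → ℝ, Continuous f →
      Continuous fun μ : ProbabilityMeasure X => ∫ x, f x ∂(μ : Measure X) := fun f hf =>
    ProbabilityMeasure.continuous_iff_forall_continuous_integral.1 continuous_id
      (BoundedContinuousFunction.mkOfCompact ⟨f, hf⟩)
  have hF : Continuous fun μ : ProbabilityMeasure X =>
      (∫ x, g x ∂(μ : Measure X)) / (∫ x, Δ x ∂(μ : Measure X)) ^ 2 :=
    (cont g hgc).div ((cont Δ hΔc).pow 2) fun μ => (pow_pos (hΔ μ inferInstance) 2).ne'
  obtain ⟨x⟩ := ‹Nonempty X›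
  have : Nonempty (ProbabilityMeasure X) := ⟨⟨Measure.dirac x, inferInstance⟩⟩
  obtain ⟨μ, -, hμ⟩ := isCompact_univ.exists_isMaxOn Set.univ_nonempty hF.continuousOn
  refine ⟨μ, inferInstance, fun ν hν => ?_⟩
  have h := hμ (Set.mem_univ (⟨ν, hν⟩ : ProbabilityMeasure X))
  exact (div_le_div_iff₀ (pow_pos (hΔ ν hν) 2) (pow_pos (hΔ μ inferInstance) 2)).1 h

/-- Lemma 3: there exists a Borel probability measure `μ*` on the compact metric space `𝒳`
supported on at most two points which minimizes `Ψ` over all Borel probability measures. -/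
theorem stmt_4
    {X : Type*} [MetricSpace X] [CompactSpace X] [MeasurableSpace X] [BorelSpace X]
    (Δ g : X → ℝ) (hΔc : Continuous Δ) (hgc : Continuous g)
    (hΔ0 : ∀ x, 0 ≤ Δ x) (hg0 : ∀ x, 0 ≤ g x) (hg : ∃ x, g x ≠ 0) :
    ∃ μs : Measure X, IsProbabilityMeasure μs ∧
      (∃ x y : X, μs ({x, y} : Set X)ᶜ = 0) ∧
      ∀ μ : Measure X, IsProbabilityMeasure μ → ratioPsi Δ g μs ≤ ratioPsi Δ g μ := by
  have hint : ∀ (f : X → ℝ), Continuous f → ∀ μ : Measure X, IsProbabilityMeasure μ →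
      Integrable f μ := fun f hf μ _ => hf.integrable_of_hasCompactSupport
        (HasCompactSupport.of_compactSpace f)
  by_cases hz : ∃ x, Δ x = 0
  · obtain ⟨x, hx⟩ := hz
    exact ⟨Measure.dirac x, inferInstance, ⟨x, x, by simp⟩, fun μ _ => by simp [ratioPsi, hx]⟩
  push Not at hz
  have hpos : ∀ x, 0 < Δ x := fun x => (hΔ0 x).lt_of_ne' (hz x)
  have hΔpos : ∀ μ : Measure X, IsProbabilityMeasure μ → 0 < ∫ x, Δ x ∂μ := by
    intro μ hμ
    obtain ⟨x, hx⟩ := exists_le_integral (hint Δ hΔc μ hμ)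
    exact (hpos x).trans_le hx
  obtain ⟨x₀, hx₀⟩ := hg
  have : Nonempty X := ⟨x₀⟩
  obtain ⟨μ, hμ, hmax⟩ := exists_probabilityMeasure_mul_sq_integral_le hΔc hgc hΔpos
  have hΔi := hint Δ hΔc μ hμ
  have hgi := hint g hgc μ hμ
  set a := ∫ x, Δ x ∂μ with ha_def
  set b := ∫ x, g x ∂μ with hb_def
  have ha : 0 < a := hΔpos μ hμ
  have hb : 0 < b := by
    have h := hmax (Measure.dirac x₀) inferInstance
    simp only [integral_dirac] at h
    have hgx : 0 < g x₀ := (hg0 x₀).lt_of_ne' hx₀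
    exact pos_of_mul_pos_left ((mul_pos hgx (pow_pos ha 2)).trans_le h) (sq_nonneg _)
  have htan : ∀ x, 0 ≤ 2 * b * Δ x - a * g x - a * b := by
    intro x
    have h : a * g x ≤ 2 * b * Δ x - a * b := by
      refine tangent_bound_of_segment ha fun t ht ht1 => ?_
      have h := hmax _ (isProbabilityMeasure_diracMixture μ x ht.le ht1)
      rwa [integral_diracMixture x ht.le ht1 hΔi, integral_diracMixture x ht.le ht1 hgi] at h
    linarith
  have hzero : ∫ x, (2 * b * Δ x - a * g x - a * b) ∂μ = 0 := by
    have hsub : Integrable (fun x => 2 * b * Δ x - a * g x) μ :=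
      (hΔi.const_mul _).sub (hgi.const_mul _)
    rw [integral_sub hsub (integrable_const _), integral_sub (hΔi.const_mul _) (hgi.const_mul _), integral_const_mul, integral_const_mul]
    simp only [integral_const, probReal_univ, smul_eq_mul, ← ha_def, ← hb_def]
    ring
  have hae := (integral_eq_zero_iff_of_nonneg htan
    (((hΔi.const_mul _).sub (hgi.const_mul _)).sub (integrable_const _))).1 hzero
  obtain ⟨x, hxN, hx⟩ := exists_notMem_null_le_integral hΔi (ae_iff.1 hae)
  obtain ⟨y, hyN, hy⟩ := exists_notMem_null_integral_le hΔi (ae_iff.1 hae)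
  replace hxN : 2 * b * Δ x - a * g x - a * b = 0 := by simpa using hxN
  replace hyN : 2 * b * Δ y - a * g y - a * b = 0 := by simpa using hyN
  obtain ⟨s, t, hs, ht, hst, hcomb⟩ : a ∈ segment ℝ (Δ x) (Δ y) := by
    rw [segment_eq_Icc (hx.trans hy)]
    exact ⟨hx, hy⟩
  obtain rfl : s = 1 - t := by linarith
  have ht1 : t ≤ 1 := by linarith
  simp only [smul_eq_mul] at hcomb
  have hprob := isProbabilityMeasure_diracMixture (Measure.dirac x) y ht ht1
  have hgcomb : (1 - t) * g x + t * g y = b := by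
    refine mul_left_cancel₀ ha.ne' ?_
    linear_combination 2 * b * hcomb - (1 - t) * hxN - t * hyN
  refine ⟨diracMixture (Measure.dirac x) y t, hprob, ⟨x, y, ?_⟩, fun ν hν => ?_⟩
  · simp [diracMixture]
  · rw [ratioPsi, ratioPsi, integral_diracMixture y ht ht1 (hint Δ hΔc _ inferInstance),
      integral_diracMixture y ht ht1 (hint g hgc _ inferInstance), integral_dirac, integral_dirac,
      hcomb, hgcomb]
    exact ENNReal.ofReal_div_ofReal_le_of_mul_le hb (pow_pos (hΔpos ν hν) 2) (hmax ν hν)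
end

section
/- There exists a Borel probability measure μ* on 𝒳 such that Ψ(μ*) = inf over all Borel probability measures μ on 𝒳 of Ψ(μ); i.e., the infimum of the ratio Ψ over the space of Borel probability measures on 𝒳 is attained. -/
open MeasureTheory
open scoped ENNReal

/-- Integration of a continuous function on a compact space is continuous in the
probability measure, for the topology of weak convergence. -/
theorem continuous_integral_probabilityMeasure {X : Type*} [TopologicalSpace X] [CompactSpace X]
    [MeasurableSpace X] [OpensMeasurableSpace X] {f : X → ℝ} (hf : Continuous f) :
    Continuous fun μ : ProbabilityMeasure X => ∫ x, f x ∂(μ : Measure X) :=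
  ProbabilityMeasure.continuous_integral_boundedContinuousFunction
    (BoundedContinuousFunction.mkOfCompact ⟨f, hf⟩)

/-- The ratio `Ψ` is weakly continuous when its numerator never vanishes. -/
theorem continuous_ratioPsi {X : Type*} [TopologicalSpace X] [CompactSpace X]
    [MeasurableSpace X] [OpensMeasurableSpace X] {Δ g : X → ℝ}
    (hΔ : Continuous Δ) (hg : Continuous g)
    (h : ∀ μ : ProbabilityMeasure X, ∫ x, Δ x ∂(μ : Measure X) ≠ 0) :
    Continuous fun μ : ProbabilityMeasure X => ratioPsi Δ g (μ : Measure X) := by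
  refine continuous_iff_continuousAt.2 fun μ => ?_
  refine ENNReal.Tendsto.div ?_ (Or.inl ?_) ?_ (Or.inl ENNReal.ofReal_ne_top)
  · exact (ENNReal.continuous_ofReal.comp
      ((continuous_integral_probabilityMeasure hΔ).pow 2)).continuousAt
  · have := h μ
    exact (ENNReal.ofReal_pos.2 (by positivity)).ne'
  · exact (ENNReal.continuous_ofReal.comp
      (continuous_integral_probabilityMeasure hg)).continuousAt

/-- Lemma (existence of a minimizer): the infimum of `Ψ` over all Borel probability measures
on the compact metric space `𝒳` is attained. -/
theorem stmt_5
    {X : Type*} [MetricSpace X] [CompactSpace X] [MeasurableSpace X] [BorelSpace X]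
    (Δ g : X → ℝ) (hΔc : Continuous Δ) (hgc : Continuous g)
    (hΔ0 : ∀ x, 0 ≤ Δ x) (hg0 : ∀ x, 0 ≤ g x) (hg : ∃ x, g x ≠ 0) :
    ∃ μs : Measure X, IsProbabilityMeasure μs ∧
      ratioPsi Δ g μs = ⨅ μ : {μ : Measure X // IsProbabilityMeasure μ}, ratioPsi Δ g μ := by
  by_cases h : ∃ μ : ProbabilityMeasure X, ∫ x, Δ x ∂(μ : Measure X) = 0
  · obtain ⟨μ, hμ⟩ := h
    have h0 : ratioPsi Δ g (μ : Measure X) = 0 := by simp [ratioPsi, hμ]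
    refine ⟨μ, μ.2, le_antisymm (h0 ▸ zero_le) ?_⟩
    exact iInf_le_of_le ⟨μ, μ.2⟩ le_rfl
  · push Not at h
    obtain ⟨x, -⟩ := hg
    have : Nonempty (ProbabilityMeasure X) := ⟨⟨Measure.dirac x, inferInstance⟩⟩
    obtain ⟨μ, -, hμ⟩ := isCompact_univ.exists_isMinOn Set.univ_nonempty
      (continuous_ratioPsi hΔc hgc h).continuousOn
    refine ⟨μ, μ.2, le_antisymm (le_iInf fun ν => ?_) ?_⟩
    · exact hμ (Set.mem_univ (⟨ν.1, ν.2⟩ : ProbabilityMeasure X))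
    · exact iInf_le_of_le ⟨μ, μ.2⟩ le_rfl
end

section
/- The IDS, DIDS and UCB choices satisfy Ψ⁺(μ_IDS) ≤ Ψ⁺(δ_{x_DIDS}) ≤ Ψ⁺(δ_{x_UCB}). Moreover, if I(x) = log(1 + σ(x)²/ρ(x)²), then Ψ⁺(δ_{x_UCB}) = 4β²σ(x_UCB)² / log(1 + σ(x_UCB)²/ρ(x_UCB)²), and if in addition log(1 + σ(x_UCB)²/ρ(x_UCB)²) ≤ 1, then Ψ⁺(δ_{x_UCB}) ≤ 8β²ρ(x_UCB)². -/
open MeasureTheory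

/-- If `0 < u` and `log (1 + u) ≤ 1`, then `u ≤ 2 log (1 + u)`. -/
theorem le_two_mul_log_one_add {u : ℝ} (hu : 0 < u) (h : Real.log (1 + u) ≤ 1) :
    u ≤ 2 * Real.log (1 + u) := by
  have hpos : 0 < Real.log (1 + u) := Real.log_pos (by linarith)
  have hexp := Real.abs_exp_sub_one_sub_id_le (abs_le.2 ⟨by linarith, h⟩)
  rw [Real.exp_log (by linarith)] at hexp
  nlinarith [(abs_le.1 hexp).2]

/-- Lemma 6: the IDS, DIDS and UCB choices satisfy
`Ψ⁺(μ_IDS) ≤ Ψ⁺(δ_{x_DIDS}) ≤ Ψ⁺(δ_{x_UCB})`; moreover, if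
`I(x) = log(1 + σ(x)²/ρ(x)²)`, then
`Ψ⁺(δ_{x_UCB}) = 4β²σ(x_UCB)²/log(1 + σ(x_UCB)²/ρ(x_UCB)²)`, and if in addition
`log(1 + σ(x_UCB)²/ρ(x_UCB)²) ≤ 1`, then `Ψ⁺(δ_{x_UCB}) ≤ 8β²ρ(x_UCB)²`.
Here `Δ⁺(x) = max_{x'}(f̂(x') + βσ(x')) − (f̂(x) − βσ(x))` and
`Ψ⁺(μ) = (∫ Δ⁺ dμ)²/(∫ I dμ)`. -/
theorem stmt_10
    {X : Type*} [MetricSpace X] [CompactSpace X] [MeasurableSpace X] [BorelSpace X]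
    [Nonempty X]
    (fh σ ρ I : X → ℝ) (β : ℝ) (hβ : 0 < β)
    (hfh : Continuous fh) (hσc : Continuous σ) (hσ : ∀ x, 0 < σ x)
    (hρc : Continuous ρ) (hρ : ∀ x, 0 < ρ x)
    (hIc : Continuous I) (hI : ∀ x, 0 < I x)
    (Δp : X → ℝ)
    (hΔp : Δp = fun x => (⨆ x' : X, (fh x' + β * σ x')) - (fh x - β * σ x))
    (Ψp : Measure X → ℝ)
    (hΨp : Ψp = fun μ => (∫ x, Δp x ∂μ)^2 / (∫ x, I x ∂μ))
    (xU xD : X) (μIDS : Measure X) [IsProbabilityMeasure μIDS]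
    (hxU : ∀ x, fh x + β * σ x ≤ fh xU + β * σ xU)
    (hxD : ∀ x : X, Ψp (Measure.dirac xD) ≤ Ψp (Measure.dirac x))
    (hIDS : ∀ μ : Measure X, IsProbabilityMeasure μ → Ψp μIDS ≤ Ψp μ) :
    Ψp μIDS ≤ Ψp (Measure.dirac xD) ∧
    Ψp (Measure.dirac xD) ≤ Ψp (Measure.dirac xU) ∧
    ((I = fun x => Real.log (1 + (σ x)^2 / (ρ x)^2)) →
      (Ψp (Measure.dirac xU) =
          4 * β^2 * (σ xU)^2 / Real.log (1 + (σ xU)^2 / (ρ xU)^2) ∧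
        (Real.log (1 + (σ xU)^2 / (ρ xU)^2) ≤ 1 →
          Ψp (Measure.dirac xU) ≤ 8 * β^2 * (ρ xU)^2))) := by
  refine ⟨hIDS _ inferInstance, hxD xU, fun hIlog => ?_⟩
  have hsup : (⨆ x' : X, (fh x' + β * σ x')) = fh xU + β * σ xU :=
    le_antisymm (ciSup_le hxU)
      (le_ciSup (f := fun x' => fh x' + β * σ x') ⟨_, Set.forall_mem_range.2 hxU⟩ xU)
  have heq : Ψp (Measure.dirac xU) =
      4 * β^2 * (σ xU)^2 / Real.log (1 + (σ xU)^2 / (ρ xU)^2) := by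
    simp only [hΨp, integral_dirac, hΔp, hsup, hIlog]
    ring
  refine ⟨heq, fun hlog => ?_⟩
  have hσU := hσ xU
  have hρU := hρ xU
  have hu : 0 < (σ xU)^2 / (ρ xU)^2 := by positivity
  have hbound := le_two_mul_log_one_add hu hlog
  rw [div_le_iff₀ (by positivity)] at hbound
  rw [heq, div_le_iff₀ (Real.log_pos (by linarith))]
  linarith [mul_le_mul_of_nonneg_left hbound (by positivity : 0 ≤ 4 * β^2)]
end

section
/- For all real numbers a, b with a ≥ 1 and b ≥ 1, √( a·b·log(a·b) ) ≤ a + b·log(b). -/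
/-- For all real numbers `a, b` with `a ≥ 1` and `b ≥ 1`,
`√(a·b·log(a·b)) ≤ a + b·log b`. -/
theorem stmt_19 (a b : ℝ) (ha : 1 ≤ a) (hb : 1 ≤ b) :
    Real.sqrt (a * b * Real.log (a * b)) ≤ a + b * Real.log b := by
  have ha0 : 0 < a := by linarith
  have hb0 : 0 < b := by linarith
  have hlog : 0 ≤ Real.log b := Real.log_nonneg hb
  have hdiv : Real.log a - Real.log b ≤ a / b - 1 := by
    rw [← Real.log_div ha0.ne' hb0.ne']
    exact Real.log_le_sub_one_of_pos (div_pos ha0 hb0)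
  have hmul : a * b * (Real.log a - Real.log b) ≤ a * (a - b) := by
    calc a * b * (Real.log a - Real.log b) ≤ a * b * (a / b - 1) := by gcongr
      _ = a * (a - b) := by field_simp
  apply Real.sqrt_le_iff.mpr
  refine ⟨by positivity, ?_⟩
  rw [Real.log_mul ha0.ne' hb0.ne']
  nlinarith [sq_nonneg (b * Real.log b), mul_pos ha0 hb0]
end
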